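/- Let g be a C² function on an open set U ⊆ ℝ³ with coordinates (x₀,x₁,x₂). For λ ∈ ℝ let α_λ be the 1-form with components A₀(λ) = 1 − λg₂ − λ²g₁, A₁(λ) = λ − λ²g₂, A₂(λ) = λ². Then the Frobenius condition α_λ ∧ dα_λ = 0 holds on U for every λ ∈ ℝ — explicitly, A₀(∂₁A₂ − ∂₂A₁) − A₁(∂₀A₂ − ∂₂A₀) + A₂(∂₀A₁ − ∂₁A₀) = 0 on U for every λ — if and only if g satisfies the hyper-CR equation g₂g₁₂ − g₁g₂₂ + g₁₁ − g₀₂ = 0 on U. -/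

import Mathlib

/-- Partial derivative `∂f/∂x_j` on ℝ³. -/
noncomputable def pd (f : (Fin 3 → ℝ) → ℝ) (j : Fin 3) (x : Fin 3 → ℝ) : ℝ :=
  fderiv ℝ f x (Pi.single j 1)

/-- Second partial derivative `∂²f/∂x_i∂x_j` on ℝ³. -/
noncomputable def pd2 (f : (Fin 3 → ℝ) → ℝ) (i j : Fin 3) (x : Fin 3 → ℝ) : ℝ :=
  pd (pd f j) i x

/-- The components of the 1-form `α_λ`:
`A₀ = 1 − λg₂ − λ²g₁`, `A₁ = λ − λ²g₂`, `A₂ = λ²`. -/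
noncomputable def A (g : (Fin 3 → ℝ) → ℝ) (lam : ℝ) : Fin 3 → (Fin 3 → ℝ) → ℝ :=
  ![fun y => 1 - lam * pd g 2 y - lam ^ 2 * pd g 1 y,
    fun y => lam - lam ^ 2 * pd g 2 y,
    fun _ => lam ^ 2]

lemma differentiableAt_pd {g : (Fin 3 → ℝ) → ℝ} {x : Fin 3 → ℝ} (hg : ContDiffAt ℝ 2 g x)
    (j : Fin 3) : DifferentiableAt ℝ (pd g j) x :=
  ((hg.fderiv_right (m := 1) (by norm_num)).differentiableAt one_ne_zero).clm_apply
    (differentiableAt_const _)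

lemma pd2_eq_fderiv_fderiv {g : (Fin 3 → ℝ) → ℝ} {x : Fin 3 → ℝ} (hg : ContDiffAt ℝ 2 g x)
    (i j : Fin 3) :
    pd2 g i j x = fderiv ℝ (fderiv ℝ g) x (Pi.single i 1) (Pi.single j 1) := by
  have h := (hg.fderiv_right (m := 1) (by norm_num)).differentiableAt one_ne_zero
  change fderiv ℝ (fun y => fderiv ℝ g y (Pi.single j 1)) x (Pi.single i 1) = _
  rw [fderiv_clm_apply h (differentiableAt_const _)]
  simp

lemma pd2_comm {g : (Fin 3 → ℝ) → ℝ} {x : Fin 3 → ℝ} (hg : ContDiffAt ℝ 2 g x)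
    (i j : Fin 3) : pd2 g i j x = pd2 g j i x := by
  rw [pd2_eq_fderiv_fderiv hg, pd2_eq_fderiv_fderiv hg]
  exact (hg.isSymmSndFDerivAt (by simp)).eq _ _

lemma pd_A_zero {g : (Fin 3 → ℝ) → ℝ} {x : Fin 3 → ℝ} (hg : ContDiffAt ℝ 2 g x)
    (lam : ℝ) (j : Fin 3) :
    pd (A g lam 0) j x = -lam * pd2 g j 2 x - lam ^ 2 * pd2 g j 1 x := by
  have h := (((differentiableAt_pd hg 2).hasFDerivAt.const_mul lam).const_sub 1).sub
    ((differentiableAt_pd hg 1).hasFDerivAt.const_mul (lam ^ 2))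
  have e : pd (A g lam 0) j x = _ := congrArg (· (Pi.single j 1)) h.fderiv
  rw [e]
  simp [pd2, pd]

lemma pd_A_one {g : (Fin 3 → ℝ) → ℝ} {x : Fin 3 → ℝ} (hg : ContDiffAt ℝ 2 g x)
    (lam : ℝ) (j : Fin 3) :
    pd (A g lam 1) j x = -lam ^ 2 * pd2 g j 2 x := by
  have h := ((differentiableAt_pd hg 2).hasFDerivAt.const_mul (lam ^ 2)).const_sub lam
  have e : pd (A g lam 1) j x = _ := congrArg (· (Pi.single j 1)) h.fderiv
  rw [e]
  simp [pd2, pd]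

lemma pd_A_two (g : (Fin 3 → ℝ) → ℝ) (x : Fin 3 → ℝ) (lam : ℝ) (j : Fin 3) :
    pd (A g lam 2) j x = 0 := by
  simp [pd, A]

/-- The coefficient of `α_λ ∧ dα_λ` is `λ⁴` times the hyper-CR expression. -/
lemma frobenius_eq_hyperCR {g : (Fin 3 → ℝ) → ℝ} {x : Fin 3 → ℝ} (hg : ContDiffAt ℝ 2 g x)
    (lam : ℝ) :
    A g lam 0 x * (pd (A g lam 2) 1 x - pd (A g lam 1) 2 x)
      - A g lam 1 x * (pd (A g lam 2) 0 x - pd (A g lam 0) 2 x)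
      + A g lam 2 x * (pd (A g lam 1) 0 x - pd (A g lam 0) 1 x)
    = lam ^ 4 * (pd g 2 x * pd2 g 1 2 x - pd g 1 x * pd2 g 2 2 x
      + pd2 g 1 1 x - pd2 g 0 2 x) := by
  have h0 : A g lam 0 x = 1 - lam * pd g 2 x - lam ^ 2 * pd g 1 x := rfl
  have h1 : A g lam 1 x = lam - lam ^ 2 * pd g 2 x := rfl
  have h2 : A g lam 2 x = lam ^ 2 := rfl
  simp only [pd_A_zero hg, pd_A_one hg, pd_A_two, h0, h1, h2, pd2_comm hg 2 1]
  ring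

/-- For a C² function `g` on an open `U ⊆ ℝ³`, the Frobenius condition
`α_λ ∧ dα_λ = 0` holds on `U` for every `λ ∈ ℝ` if and only if `g` satisfies
the hyper-CR equation `g₂g₁₂ − g₁g₂₂ + g₁₁ − g₀₂ = 0` on `U`. -/
theorem frobenius_iff_hyperCR
    (U : Set (Fin 3 → ℝ)) (hU : IsOpen U)
    (g : (Fin 3 → ℝ) → ℝ) (hg : ContDiffOn ℝ 2 g U) :
    (∀ lam : ℝ, ∀ x ∈ U,
      A g lam 0 x * (pd (A g lam 2) 1 x - pd (A g lam 1) 2 x)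
      - A g lam 1 x * (pd (A g lam 2) 0 x - pd (A g lam 0) 2 x)
      + A g lam 2 x * (pd (A g lam 1) 0 x - pd (A g lam 0) 1 x) = 0)
    ↔
    (∀ x ∈ U,
      pd g 2 x * pd2 g 1 2 x - pd g 1 x * pd2 g 2 2 x
      + pd2 g 1 1 x - pd2 g 0 2 x = 0) := by
  have hx : ∀ x ∈ U, ContDiffAt ℝ 2 g x := fun x h => hg.contDiffAt (hU.mem_nhds h)
  constructor
  · intro h x hxU
    simpa [frobenius_eq_hyperCR (hx x hxU)] using h 1 x hxU
  · intro h lam x hxU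
    rw [frobenius_eq_hyperCR (hx x hxU), h x hxU, mul_zero]
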